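/- Let a : ℝ → ℝ^d be measurable and bounded on a bounded Borel set E ⊂ ℝ, and suppose that for every ν ∈ S^d (unit sphere in ℝ^{d+1}), the Lebesgue measure of {ξ ∈ E : (1, a(ξ))·ν = 0} is zero. Then for the translation flows φ^ξ_{−t}(x) = x + t a(ξ) on 𝕋^d, the quantity |ā|(T;E) = sup_{v ∈ L²₀(𝕋^d), ‖v‖=1, ζ ∈ E} ∫_E |(1/T)∫₀^T ⟨v∘φ^ξ_{−t}, v∘φ^ζ_{−t}⟩_{L²(𝕋^d)} dt| dξ tends to 0 as T → +∞. -/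

import Mathlib

open MeasureTheory Filter

/-- The translation of the torus `𝕋^d = (ℝ/ℤ)^d` by a vector `h ∈ ℝ^d`. -/
noncomputable def torusShift {d : ℕ} (h : Fin d → ℝ) : Fin d → AddCircle (1 : ℝ) :=
  fun i => (h i : AddCircle (1 : ℝ))


lemma expAvg (T l : ℝ) (hT : 0 < T) :
    ‖(1 / T : ℂ) * ∫ t in (0:ℝ)..T, Complex.exp (2 * Real.pi * Complex.I * l * t)‖
      ≤ 2 / (1 + T * |l|) := by
  set x := ‖(1 / T : ℂ) * ∫ t in (0:ℝ)..T, Complex.exp (2 * Real.pi * Complex.I * l * t)‖ with hx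
  have hn : ‖(1 / T : ℂ)‖ = 1 / T := by simp [abs_of_pos hT]
  have hexp : ∀ t : ℝ, ‖Complex.exp (2 * Real.pi * Complex.I * l * t)‖ = 1 := by
    intro t
    rw [show (2 * Real.pi * Complex.I * l * t : ℂ) = ((2 * Real.pi * l * t : ℝ) : ℂ) * Complex.I by
      push_cast; ring]
    exact Complex.norm_exp_ofReal_mul_I _
  have h1 : x ≤ 1 := by
    rw [hx, norm_mul, hn]
    have := intervalIntegral.norm_integral_le_of_norm_le_const (a := 0) (b := T) (C := 1)
      (f := fun t : ℝ => Complex.exp (2 * Real.pi * Complex.I * l * t)) (fun t _ => (hexp t).le)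
    rw [sub_zero, abs_of_pos hT, one_mul] at this
    calc _ ≤ 1 / T * T := by gcongr
      _ = 1 := by field_simp
  have h2 : x * (T * |l|) ≤ 1 := by
    by_cases hl : l = 0
    · simp [hl]
    have hc : (2 * Real.pi * Complex.I * l : ℂ) ≠ 0 := by
      simp [hl, Real.pi_ne_zero]
    rw [hx, norm_mul, hn, integral_exp_mul_complex hc, norm_div]
    have h3 : ‖(2 * Real.pi * Complex.I * l : ℂ)‖ = 2 * Real.pi * |l| := by
      simp [abs_of_pos Real.pi_pos]
    have h4 : ‖Complex.exp (2 * Real.pi * Complex.I * l * T) -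
        Complex.exp (2 * Real.pi * Complex.I * l * (0:ℝ))‖ ≤ 2 := by
      refine (norm_sub_le _ _).trans ?_
      rw [hexp, hexp]; norm_num
    rw [h3]
    have hl' : 0 < |l| := abs_pos.mpr hl
    calc _ ≤ 1 / T * (2 / (2 * Real.pi * |l|)) * (T * |l|) := by
            have := Real.pi_pos
            gcongr
      _ = 1 / Real.pi := by field_simp
      _ ≤ 1 := by
        rw [div_le_one Real.pi_pos]; linarith [Real.pi_gt_three]
  rw [le_div_iff₀ (by positivity)]
  linarith

lemma timeAvg {ι : Type*} [Countable ι] (w l : ι → ℝ) (hw : ∀ n, 0 ≤ w n) (hs : Summable w)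
    (g : ℝ → ℝ)
    (hg : ∀ t : ℝ, HasSum (fun n => (w n : ℂ) * Complex.exp (2 * Real.pi * Complex.I * l n * t))
      (g t : ℂ)) (T : ℝ) (hT : 0 < T) :
    |(1 / T) * ∫ t in (0:ℝ)..T, g t| ≤ ∑' n, w n * (2 / (1 + T * |l n|)) := by
  have hexp : ∀ (n) (t : ℝ), ‖(w n : ℂ) * Complex.exp (2 * Real.pi * Complex.I * l n * t)‖ = w n := by
    intro n t
    rw [show (2 * Real.pi * Complex.I * l n * t : ℂ) =
      ((2 * Real.pi * l n * t : ℝ) : ℂ) * Complex.I by push_cast; ring]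
    rw [norm_mul, Complex.norm_exp_ofReal_mul_I]
    simp [abs_of_nonneg (hw n)]
  have h1 := intervalIntegral.hasSum_integral_of_dominated_convergence (μ := volume)
    (a := 0) (b := T)
    (F := fun n (t : ℝ) => (w n : ℂ) * Complex.exp (2 * Real.pi * Complex.I * l n * t))
    (f := fun t => (g t : ℂ)) (fun n _ => w n)
    (fun n => by
      apply Continuous.aestronglyMeasurable
      fun_prop)
    (fun n => ae_of_all _ fun t _ => (hexp n t).le)
    (ae_of_all _ fun t _ => hs) (by simp) (ae_of_all _ fun t _ => hg t)
  have h2 := h1.mul_left (1 / T : ℂ)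
  have h3 : ((1 / T : ℂ)) * ∫ t in (0:ℝ)..T, (g t : ℂ) =
      (((1 / T) * ∫ t in (0:ℝ)..T, g t : ℝ) : ℂ) := by
    rw [intervalIntegral.integral_ofReal]; push_cast; rfl
  rw [h3] at h2
  have hb : ∀ n, ‖(1 / T : ℂ) * ∫ t in (0:ℝ)..T,
      (w n : ℂ) * Complex.exp (2 * Real.pi * Complex.I * l n * t)‖ ≤
      w n * (2 / (1 + T * |l n|)) := by
    intro n
    rw [intervalIntegral.integral_const_mul, mul_left_comm, norm_mul]
    have := expAvg T (l n) hT
    have h0 : ‖(w n : ℂ)‖ = w n := by simp [abs_of_nonneg (hw n)]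
    rw [h0]
    exact mul_le_mul_of_nonneg_left this (hw n)
  have hs2 : Summable fun n => w n * (2 / (1 + T * |l n|)) := by
    refine Summable.of_nonneg_of_le (fun n => by have := hw n; positivity) (fun n => ?_)
      (hs.mul_right 2)
    refine mul_le_mul_of_nonneg_left ?_ (hw n)
    apply div_le_self (by norm_num)
    have : 0 ≤ T * |l n| := by positivity
    linarith
  have h4 := h2.tsum_eq
  have h5 := tsum_of_norm_bounded hs2.hasSum hb
  rw [h4, Complex.norm_real, Real.norm_eq_abs] at h5
  exact h5

lemma sphereUnif {d : ℕ} (E : Set ℝ) (hE : MeasurableSet E) (hEbdd : Bornology.IsBounded E)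
    (a : ℝ → (Fin d → ℝ)) (ha : Measurable a)
    (hnd : ∀ (ν₀ : ℝ) (ν : Fin d → ℝ), ν₀ ^ 2 + (∑ i, ν i ^ 2) = 1 →
      volume {ξ ∈ E | ν₀ + ∑ i, a ξ i * ν i = 0} = 0) (ε : ℝ) (hε : 0 < ε) :
    ∃ k : ℕ, ∀ (ν₀ : ℝ) (ν : Fin d → ℝ), ν₀ ^ 2 + (∑ i, ν i ^ 2) = 1 →
      ∫ ξ in E, 2 / (1 + (k : ℝ) * |ν₀ + ∑ i, a ξ i * ν i|) < ε := by
  have : IsFiniteMeasure (volume.restrict E) := ⟨by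
    rw [Measure.restrict_apply_univ]; exact hEbdd.measure_lt_top⟩
  have hmeas : ∀ (k : ℕ) (p : ℝ × (Fin d → ℝ)),
      Measurable fun ξ => 2 / (1 + (k : ℝ) * |p.1 + ∑ i, a ξ i * p.2 i|) := by
    intro k p
    have : ∀ i, Measurable fun ξ => a ξ i := fun i => (measurable_pi_apply i).comp ha
    fun_prop
  have hbd : ∀ (k : ℕ) (y : ℝ), ‖2 / (1 + (k : ℝ) * |y|)‖ ≤ 2 := by
    intro k y
    rw [Real.norm_of_nonneg (by positivity)]
    apply div_le_self (by norm_num)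
    have : 0 ≤ (k : ℝ) * |y| := by positivity
    linarith
  have hint : ∀ (k : ℕ) (p : ℝ × (Fin d → ℝ)),
      Integrable (fun ξ => 2 / (1 + (k : ℝ) * |p.1 + ∑ i, a ξ i * p.2 i|)) (volume.restrict E) :=
    fun k p => Integrable.of_bound (hmeas k p).aestronglyMeasurable 2
      (ae_of_all _ fun ξ => hbd _ _)
  let S : Set (ℝ × (Fin d → ℝ)) := {p | p.1 ^ 2 + ∑ i, p.2 i ^ 2 = 1}
  have hS : IsCompact S := by
    apply Metric.isCompact_of_isClosed_isBounded
    · exact isClosed_eq (by fun_prop) continuous_const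
    · refine (Metric.isBounded_closedBall (x := (0 : ℝ × (Fin d → ℝ))) (r := 1)).subset ?_
      intro p hp
      have hp' : p.1 ^ 2 + ∑ i, p.2 i ^ 2 = 1 := hp
      have hnn : 0 ≤ ∑ i, p.2 i ^ 2 := Finset.sum_nonneg fun i _ => sq_nonneg _
      rw [mem_closedBall_zero_iff, Prod.norm_def, max_le_iff,
        pi_norm_le_iff_of_nonneg zero_le_one]
      refine ⟨?_, fun i => ?_⟩
      · rw [Real.norm_eq_abs, ← sq_le_one_iff_abs_le_one]; linarith
      · rw [Real.norm_eq_abs, ← sq_le_one_iff_abs_le_one]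
        have := Finset.single_le_sum (f := fun i => p.2 i ^ 2) (fun i _ => sq_nonneg _)
          (Finset.mem_univ i)
        nlinarith [sq_nonneg p.1]
  let F : ℕ → (ℝ × (Fin d → ℝ)) → ℝ := fun k p =>
    ∫ ξ in E, 2 / (1 + (k : ℝ) * |p.1 + ∑ i, a ξ i * p.2 i|)
  have hcont : ∀ k, Continuous (F k) := by
    intro k
    refine continuous_of_dominated (bound := fun _ => 2)
      (fun p => (hmeas k p).aestronglyMeasurable) (fun p => ae_of_all _ fun ξ => hbd _ _)
      (integrable_const _) (ae_of_all _ fun ξ => ?_)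
    refine Continuous.div (by fun_prop) (by fun_prop) fun p => ?_
    positivity
  have hanti : ∀ p ∈ S, Antitone (fun k => F k p) := by
    intro p _ k m hkm
    refine integral_mono (hint m p) (hint k p) fun ξ => ?_
    have : (k : ℝ) ≤ m := by exact_mod_cast hkm
    simp only
    gcongr
  have hlim : ∀ p ∈ S, Tendsto (fun k => F k p) atTop (nhds 0) := by
    intro p hp
    have h0 : (0:ℝ) = ∫ ξ in E, (0:ℝ) := by simp
    rw [h0]
    refine tendsto_integral_of_dominated_convergence (fun _ => 2)
      (fun k => (hmeas k p).aestronglyMeasurable) (integrable_const _)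
      (fun k => ae_of_all _ fun ξ => hbd _ _) ?_
    have hz := hnd p.1 p.2 hp
    rw [ae_restrict_iff' hE]
    have : ∀ᵐ ξ, ¬ (ξ ∈ {ξ ∈ E | p.1 + ∑ i, a ξ i * p.2 i = 0}) := measure_eq_zero_iff_ae_notMem.mp hz
    filter_upwards [this] with ξ hξ hξE
    have hne : p.1 + ∑ i, a ξ i * p.2 i ≠ 0 := fun h => hξ ⟨hξE, h⟩
    apply Tendsto.const_div_atTop
    apply tendsto_atTop_add_const_left
    exact tendsto_natCast_atTop_atTop.atTop_mul_const (abs_pos.mpr hne)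
  have hU : TendstoUniformlyOn F (fun _ => 0) atTop S :=
    Antitone.tendstoUniformlyOn_of_forall_tendsto hS (fun k => (hcont k).continuousOn) hanti
      continuousOn_const hlim
  rw [Metric.tendstoUniformlyOn_iff] at hU
  obtain ⟨k, hk⟩ := (hU ε hε).exists
  refine ⟨k, fun ν₀ ν h => ?_⟩
  have := hk (ν₀, ν) h
  rw [dist_comm, Real.dist_eq, sub_zero] at this
  exact (le_abs_self _).trans_lt this

lemma torusVol (d : ℕ) : (volume : Measure (Fin d → AddCircle (1:ℝ))) =
    Measure.pi (fun _ => AddCircle.haarAddCircle) := by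
  rw [volume_pi]
  simp [AddCircle.volume_eq_smul_haarAddCircle]

lemma parsevalTorus {d : ℕ} (f g : (Fin d → AddCircle (1:ℝ)) → ℂ) (hf : MemLp f 2 volume)
    (hg : MemLp g 2 volume) :
    HasSum (fun n : Fin d → ℤ =>
      starRingEnd ℂ (∫ x, UnitAddTorus.mFourier (-n) x * f x) *
        ∫ x, UnitAddTorus.mFourier (-n) x * g x) (∫ x, starRingEnd ℂ (f x) * g x) := by
  rw [torusVol] at *
  have h := UnitAddTorus.hasSum_prod_mFourierCoeff (d := Fin d) (hf.toLp f) (hg.toLp g)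
  have e1 : ∀ᵐ x ∂(Measure.pi (fun _ : Fin d => AddCircle.haarAddCircle (T := (1:ℝ)))),
    hf.toLp f x = f x := hf.coeFn_toLp
  have e2 : ∀ᵐ x ∂(Measure.pi (fun _ : Fin d => AddCircle.haarAddCircle (T := (1:ℝ)))),
    hg.toLp g x = g x := hg.coeFn_toLp
  convert! h using 1
  · funext n
    unfold UnitAddTorus.mFourierCoeff
    congr 1
    · congr 1
      apply integral_congr_ae
      filter_upwards [e1] with x hx
      simp [hx]
    · apply integral_congr_ae
      filter_upwards [e2] with x hx
      simp [hx]
  · apply integral_congr_ae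
    filter_upwards [e1, e2] with x hx hx2
    simp [hx, hx2]

lemma mFourier_add_pt {d : ℕ} (n : Fin d → ℤ) (x y : Fin d → AddCircle (1:ℝ)) :
    UnitAddTorus.mFourier n (x + y) = UnitAddTorus.mFourier n x * UnitAddTorus.mFourier n y := by
  simp only [UnitAddTorus.mFourier, ContinuousMap.coe_mk, ← Finset.prod_mul_distrib]
  refine Finset.prod_congr rfl fun i _ => ?_
  simp [fourier_apply, smul_add, AddCircle.toCircle_add]

lemma mFourier_shift {d : ℕ} (n : Fin d → ℤ) (h : Fin d → ℝ) :
    UnitAddTorus.mFourier n (torusShift h) =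
      Complex.exp (2 * Real.pi * Complex.I * ((∑ i, n i * h i : ℝ) : ℂ)) := by
  simp only [UnitAddTorus.mFourier, ContinuousMap.coe_mk, torusShift]
  push_cast
  rw [Finset.mul_sum, Complex.exp_sum]
  refine Finset.prod_congr rfl fun i _ => ?_
  rw [fourier_coe_apply]
  congr 1
  push_cast
  ring

lemma coeff_shift {d : ℕ} (f : (Fin d → AddCircle (1:ℝ)) → ℂ) (n : Fin d → ℤ) (h : Fin d → ℝ) :
    (∫ x, UnitAddTorus.mFourier (-n) x * f (x + torusShift h)) =
      Complex.exp (2 * Real.pi * Complex.I * ((∑ i, n i * h i : ℝ) : ℂ)) *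
        ∫ x, UnitAddTorus.mFourier (-n) x * f x := by
  rw [← mFourier_shift, ← integral_const_mul]
  rw [← integral_add_right_eq_self (fun x => UnitAddTorus.mFourier n (torusShift h) *
    (UnitAddTorus.mFourier (-n) x * f x)) (torusShift h)]
  congr 1
  funext x
  rw [mFourier_add_pt]
  have : UnitAddTorus.mFourier (-n) (torusShift h) * UnitAddTorus.mFourier n (torusShift h) = 1 := by
    rw [← UnitAddTorus.mFourier_add]
    simp [UnitAddTorus.mFourier_zero]
  linear_combination (-UnitAddTorus.mFourier (-n) x * f (x + torusShift h)) * this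

lemma corrSeries {d : ℕ} (v : (Fin d → AddCircle (1:ℝ)) → ℝ) (hv : Measurable v)
    (h0 : ∫ x, v x = 0) (h1 : ∫ x, (v x) ^ 2 = 1) :
    ∃ w : (Fin d → ℤ) → ℝ, (∀ n, 0 ≤ w n) ∧ HasSum w 1 ∧ w 0 = 0 ∧ ∀ A B : Fin d → ℝ,
      HasSum (fun n => (w n : ℂ) * Complex.exp (2 * Real.pi * Complex.I *
        ((∑ i, n i * (B i - A i) : ℝ) : ℂ)))
        ((∫ x, v (x + torusShift A) * v (x + torusShift B) : ℝ) : ℂ) := by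
  have hint : Integrable (fun x => v x ^ 2) := by
    by_contra h
    rw [integral_undef h] at h1
    norm_num at h1
  have hL : MemLp v 2 volume := (memLp_two_iff_integrable_sq hv.aestronglyMeasurable).mpr hint
  let f : (Fin d → AddCircle (1:ℝ)) → ℂ := fun x => (v x : ℂ)
  have hf : MemLp f 2 volume := hL.ofReal
  have hfs : ∀ A : Fin d → ℝ, MemLp (fun x => f (x + torusShift A)) 2 volume := fun A =>
    hf.comp_measurePreserving (measurePreserving_add_right volume (torusShift A))
  have key : ∀ A B : Fin d → ℝ,
      HasSum (fun n : Fin d → ℤ => ((‖∫ x, UnitAddTorus.mFourier (-n) x * f x‖ ^ 2 : ℝ) : ℂ) *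
        Complex.exp (2 * Real.pi * Complex.I *
        ((∑ i, n i * (B i - A i) : ℝ) : ℂ)))
        ((∫ x, v (x + torusShift A) * v (x + torusShift B) : ℝ) : ℂ) := by
    intro A B
    have h := parsevalTorus _ _ (hfs A) (hfs B)
    convert! h using 1
    · funext n
      rw [coeff_shift, coeff_shift]
      generalize (∫ x, UnitAddTorus.mFourier (-n) x * f x) = z
      rw [map_mul, ← Complex.exp_conj]
      have hz : ((‖z‖ ^ 2 : ℝ) : ℂ) = starRingEnd ℂ z * z := by
        rw [Complex.conj_mul']; push_cast; rfl
      have he : Complex.exp (2 * Real.pi * Complex.I * ((∑ i, n i * (B i - A i) : ℝ) : ℂ)) =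
          Complex.exp (starRingEnd ℂ (2 * Real.pi * Complex.I * ((∑ i, n i * A i : ℝ) : ℂ))) *
          Complex.exp (2 * Real.pi * Complex.I * ((∑ i, n i * B i : ℝ) : ℂ)) := by
        rw [← Complex.exp_add]
        congr 1
        simp only [map_mul, Complex.conj_I, Complex.conj_ofReal, map_ofNat]
        simp only [mul_sub, Finset.sum_sub_distrib]
        push_cast
        ring
      rw [hz, he]
      ring
    · rw [← integral_complex_ofReal]
      congr 1
      funext x
      simp [f]
  refine ⟨fun n => ‖∫ x, UnitAddTorus.mFourier (-n) x * f x‖ ^ 2, fun n => by positivity, ?_, ?_,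
    key⟩
  · have h := key 0 0
    have hz : torusShift (0 : Fin d → ℝ) = 0 := by
      funext i; simp [torusShift]
    rw [hz] at h
    simp only [add_zero, ← pow_two, h1] at h
    simp only [sub_self, mul_zero, Finset.sum_const_zero, Complex.ofReal_zero, Complex.exp_zero,
      mul_one] at h
    exact_mod_cast h
  · have : (∫ x, f x) = 0 := by
      simp only [f]
      rw [integral_complex_ofReal, h0]; simp
    simp [UnitAddTorus.mFourier_zero, this]

lemma modeBound {d : ℕ} (E : Set ℝ) (hEbdd : Bornology.IsBounded E)
    (a : ℝ → (Fin d → ℝ)) (ha : Measurable a) (ε : ℝ) (k : ℕ)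
    (hk : ∀ (ν₀ : ℝ) (ν : Fin d → ℝ), ν₀ ^ 2 + (∑ i, ν i ^ 2) = 1 →
      ∫ ξ in E, 2 / (1 + (k : ℝ) * |ν₀ + ∑ i, a ξ i * ν i|) < ε)
    (T : ℝ) (hT : (k : ℝ) ≤ T) (b : Fin d → ℝ) (n : Fin d → ℤ) (hn : n ≠ 0) :
    ∫ ξ in E, 2 / (1 + T * |∑ i, n i * (b i - a ξ i)|) ≤ ε := by
  have : IsFiniteMeasure (volume.restrict E) := ⟨by
    rw [Measure.restrict_apply_univ]; exact hEbdd.measure_lt_top⟩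
  have ham : ∀ i, Measurable fun ξ => a ξ i := fun i => (measurable_pi_apply i).comp ha
  set L : ℝ := ∑ i, n i * b i with hL
  set N : ℝ := ∑ i, (n i : ℝ) ^ 2 with hN
  have hN1 : 1 ≤ N := by
    obtain ⟨i, hi⟩ := Function.ne_iff.mp hn
    have h1 : (1 : ℝ) ≤ (n i : ℝ) ^ 2 := by
      have h2 : (1 : ℤ) ≤ (n i) ^ 2 := by
        have : 0 < (n i) ^ 2 := by
          have : n i ≠ 0 := hi
          positivity
        linarith
      exact_mod_cast h2
    exact h1.trans (Finset.single_le_sum (f := fun i => (n i : ℝ) ^ 2)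
      (fun i _ => sq_nonneg _) (Finset.mem_univ i))
  set c : ℝ := Real.sqrt (L ^ 2 + N) with hc
  have hcsq : c ^ 2 = L ^ 2 + N := Real.sq_sqrt (by positivity)
  have hc1 : 1 ≤ c := by
    rw [hc, Real.one_le_sqrt]; nlinarith [sq_nonneg L]
  have hc0 : 0 < c := by linarith
  have hsph : (L / c) ^ 2 + ∑ i, (-(n i : ℝ) / c) ^ 2 = 1 := by
    simp only [div_pow, neg_sq]
    rw [← Finset.sum_div, ← hN, ← add_div, hcsq]
    exact div_self (by rw [← hcsq]; positivity)
  refine le_trans ?_ (hk _ _ hsph).le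
  have hlam : ∀ ξ, L / c + ∑ i, a ξ i * (-(n i : ℝ) / c) = (∑ i, n i * (b i - a ξ i)) / c := by
    intro ξ
    rw [hL, eq_div_iff hc0.ne', add_mul, Finset.sum_mul, div_mul_cancel₀ _ hc0.ne',
      ← Finset.sum_add_distrib]
    refine Finset.sum_congr rfl fun i _ => ?_
    field_simp
    ring
  refine integral_mono_of_nonneg (ae_of_all _ fun ξ => ?_) ?_ (ae_of_all _ fun ξ => ?_)
  · have : 0 ≤ T := le_trans (by positivity) hT
    simp only [Pi.zero_apply]
    positivity
  · refine Integrable.of_bound (C := 2) ?_ (ae_of_all _ fun ξ => ?_)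
    · apply Measurable.aestronglyMeasurable
      fun_prop
    · rw [Real.norm_of_nonneg (by positivity)]
      apply div_le_self (by norm_num)
      have : 0 ≤ (k : ℝ) * |L / c + ∑ i, a ξ i * (-(n i : ℝ) / c)| := by positivity
      linarith
  · simp only
    rw [hlam, abs_div, abs_of_pos hc0]
    have : |∑ i, n i * (b i - a ξ i)| / c ≤ |∑ i, n i * (b i - a ξ i)| :=
      div_le_self (abs_nonneg _) hc1
    have hT0 : 0 ≤ T := le_trans (by positivity) hT
    gcongr

/-- Lemma (ndVSnd): the classical non-degeneracy condition on `(1, a(ξ))` implies that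
`|ā|(T;E) → 0` as `T → ∞`. -/
theorem classical_nondegeneracy_implies_averaged {d : ℕ}
    (E : Set ℝ) (hE : MeasurableSet E) (hEbdd : Bornology.IsBounded E)
    (a : ℝ → (Fin d → ℝ)) (ha : Measurable a)
    (M : ℝ) (haM : ∀ ξ ∈ E, ∀ i, |a ξ i| ≤ M)
    (hnd : ∀ (ν₀ : ℝ) (ν : Fin d → ℝ), ν₀ ^ 2 + (∑ i, ν i ^ 2) = 1 →
      volume {ξ ∈ E | ν₀ + ∑ i, a ξ i * ν i = 0} = 0) :
    Tendsto
      (fun T : ℝ => sSup {r : ℝ |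
        ∃ (v : (Fin d → AddCircle (1 : ℝ)) → ℝ) (ζ : ℝ), ζ ∈ E ∧ Measurable v ∧
          (∫ x, v x) = 0 ∧ (∫ x, (v x) ^ 2) = 1 ∧
          r = ∫ ξ in E, |(1 / T) * ∫ t in (0:ℝ)..T,
                ∫ x, v (x + torusShift (t • a ξ)) * v (x + torusShift (t • a ζ))|})
      atTop (nhds 0) := by
  have : IsFiniteMeasure (volume.restrict E) := ⟨by
    rw [Measure.restrict_apply_univ]; exact hEbdd.measure_lt_top⟩
  have ham : ∀ i, Measurable fun ξ => a ξ i := fun i => (measurable_pi_apply i).comp ha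
  rw [Metric.tendsto_atTop]
  intro ε hε
  obtain ⟨k, hk⟩ := sphereUnif E hE hEbdd a ha hnd (ε / 2) (half_pos hε)
  refine ⟨max k 1, fun T hT => ?_⟩
  have hkT : (k : ℝ) ≤ T := (le_max_left _ _).trans hT
  have hT0 : 0 < T := zero_lt_one.trans_le ((le_max_right _ _).trans hT)
  rw [Real.dist_eq, sub_zero, abs_of_nonneg]
  swap
  · apply Real.sSup_nonneg
    rintro r ⟨v, ζ, -, -, -, -, rfl⟩
    exact integral_nonneg fun ξ => abs_nonneg _
  refine lt_of_le_of_lt (Real.sSup_le ?_ (half_pos hε).le) (half_lt_self hε)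
  rintro r ⟨v, ζ, -, hv, h0, h1, rfl⟩
  obtain ⟨w, hw, hw1, hw0, hser⟩ := corrSeries v hv h0 h1
  let G : (Fin d → ℤ) → ℝ → ℝ := fun n ξ =>
    w n * (2 / (1 + T * |∑ i, n i * (a ζ i - a ξ i)|))
  have hG0 : ∀ n ξ, 0 ≤ G n ξ := fun n ξ => mul_nonneg (hw n) (by positivity)
  have hGle : ∀ n ξ, G n ξ ≤ w n * 2 := by
    intro n ξ
    refine mul_le_mul_of_nonneg_left ?_ (hw n)
    apply div_le_self (by norm_num)
    have : 0 ≤ T * |∑ i, n i * (a ζ i - a ξ i)| := by positivity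
    linarith
  have hs2 : Summable fun n => w n * 2 := hw1.summable.mul_right 2
  have hGs : ∀ ξ, Summable fun n => G n ξ := fun ξ =>
    Summable.of_nonneg_of_le (fun n => hG0 n ξ) (fun n => hGle n ξ) hs2
  have hGm : ∀ n, Measurable (G n) := fun n => by
    simp only [G]
    fun_prop
  have hpt : ∀ ξ, |(1 / T) * ∫ t in (0:ℝ)..T,
      ∫ x, v (x + torusShift (t • a ξ)) * v (x + torusShift (t • a ζ))| ≤ ∑' n, G n ξ := by
    intro ξ
    refine timeAvg w (fun n => ∑ i, n i * (a ζ i - a ξ i)) hw hw1.summable _ (fun t => ?_) T hT0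
    convert! hser (t • a ξ) (t • a ζ) using 3 with n
    rw [mul_assoc (2 * Real.pi * Complex.I : ℂ), ← Complex.ofReal_mul, Finset.sum_mul]
    congr 3
    refine Finset.sum_congr rfl fun i _ => ?_
    simp only [Pi.smul_apply, smul_eq_mul]
    ring
  have hGi : Integrable (fun ξ => ∑' n, G n ξ) (volume.restrict E) := by
    refine Integrable.of_bound (C := ∑' n, w n * 2) ?_ (ae_of_all _ fun ξ => ?_)
    · refine aestronglyMeasurable_of_tendsto_ae (atTop : Filter (Finset (Fin d → ℤ)))
        (f := fun s ξ => ∑ n ∈ s, G n ξ) (fun s => ?_) (ae_of_all _ fun ξ => (hGs ξ).hasSum)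
      exact (Finset.measurable_sum s fun n _ => hGm n).aestronglyMeasurable
    · rw [Real.norm_of_nonneg (tsum_nonneg fun n => hG0 n ξ)]
      exact (hGs ξ).tsum_le_tsum (fun n => hGle n ξ) hs2
  have hsum := hasSum_integral_of_dominated_convergence (μ := volume.restrict E)
    (F := G) (f := fun ξ => ∑' n, G n ξ) (fun n _ => w n * 2)
    (fun n => (hGm n).aestronglyMeasurable)
    (fun n => ae_of_all _ fun ξ => by rw [Real.norm_of_nonneg (hG0 n ξ)]; exact hGle n ξ)
    (ae_of_all _ fun ξ => hs2) (integrable_const _) (ae_of_all _ fun ξ => (hGs ξ).hasSum)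
  calc _ ≤ ∫ ξ in E, ∑' n, G n ξ :=
        integral_mono_of_nonneg (ae_of_all _ fun ξ => abs_nonneg _) hGi (ae_of_all _ hpt)
    _ ≤ 1 * (ε / 2) := by
        refine hasSum_le (fun n => ?_) hsum (hw1.mul_right (ε / 2))
        simp only [G]
        rw [integral_const_mul]
        by_cases hn : n = 0
        · simp [hn, hw0]
        · exact mul_le_mul_of_nonneg_left
            (modeBound E hEbdd a ha _ k hk T hkT (a ζ) n hn) (hw n)
    _ = ε / 2 := one_mul _
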